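/- Let P be a d-dimensional polytope with exactly d+4 vertices such that some 6 of its vertices have convex hull combinatorially equivalent to the triangular prism Δ_1 × Δ_2. Then P is an iterated pyramid over a polytope P' of one of the following two types: (1) P' is combinatorially equivalent to the join (Δ_1 × Δ_2) ⋆ (Δ_n ⊕ Δ_m) of the triangular prism with a direct sum of simplices; or (2) P' = conv(Q ∪ {p}) for a point p, where Q, the convex hull of the vertices of P' other than p, is combinatorially equivalent to the k-fold pyramid over Δ_1 × Δ_2 for some k ≥ 0. -/

import Mathlib

open Set

noncomputable section

/-- A polytope: the convex hull of a finite set of points. -/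
def IsPolytope {N : ℕ} (P : Set (Fin N → ℝ)) : Prop :=
  ∃ S : Finset (Fin N → ℝ), P = convexHull ℝ (S : Set (Fin N → ℝ))

/-- Dimension of a set: the dimension of its affine hull (with `-1` for the empty set). -/
def pdim {N : ℕ} (P : Set (Fin N → ℝ)) : ℤ :=
  haveI := Classical.dec P.Nonempty
  if P.Nonempty then (Module.finrank ℝ (affineSpan ℝ P).direction : ℤ) else -1

/-- `F` is a face of `P`: the subset of `P` where some linear functional bounded above on `P`
attains its maximum value.  This includes `∅` and `P` itself. -/
def IsFaceOf {N : ℕ} (F P : Set (Fin N → ℝ)) : Prop :=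
  ∃ (c : Fin N → ℝ) (b : ℝ),
    (∀ x ∈ P, ∑ i, c i * x i ≤ b) ∧ F = {x ∈ P | ∑ i, c i * x i = b}

/-- A facet: a face of dimension one less than the polytope. -/
def IsFacetOf {N : ℕ} (F P : Set (Fin N → ℝ)) : Prop :=
  IsFaceOf F P ∧ pdim F + 1 = pdim P

/-- A ridge: a face of dimension two less than the polytope. -/
def IsRidgeOf {N : ℕ} (F P : Set (Fin N → ℝ)) : Prop :=
  IsFaceOf F P ∧ pdim F + 2 = pdim P

def IsVertexOf {N : ℕ} (v : Fin N → ℝ) (P : Set (Fin N → ℝ)) : Prop :=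
  IsFaceOf {v} P

def vertexSet {N : ℕ} (P : Set (Fin N → ℝ)) : Set (Fin N → ℝ) :=
  {v | IsVertexOf v P}

def vertexCount {N : ℕ} (P : Set (Fin N → ℝ)) : ℕ := (vertexSet P).ncard

def facetCount {N : ℕ} (P : Set (Fin N → ℝ)) : ℕ := {F | IsFacetOf F P}.ncard

/-- Extension complexity: the minimal number of facets of a polytope (in any dimension)
admitting an affine projection onto `P`. -/
def xc {N : ℕ} (P : Set (Fin N → ℝ)) : ℕ :=
  sInf {n | ∃ (e : ℕ) (Q : Set (Fin e → ℝ)) (π : (Fin e → ℝ) →ᵃ[ℝ] (Fin N → ℝ)),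
    IsPolytope Q ∧ π '' Q = P ∧ facetCount Q = n}

/-- Combinatorial equivalence: an inclusion-preserving bijection between face lattices. -/
def CombEquiv {M N : ℕ} (P : Set (Fin M → ℝ)) (Q : Set (Fin N → ℝ)) : Prop :=
  ∃ φ : {F : Set (Fin M → ℝ) // IsFaceOf F P} ≃ {G : Set (Fin N → ℝ) // IsFaceOf G Q},
    ∀ F₁ F₂ : {F : Set (Fin M → ℝ) // IsFaceOf F P},
      F₁.1 ⊆ F₂.1 ↔ (φ F₁).1 ⊆ (φ F₂).1

/-- A full-dimensional `n`-simplex in `ℝ^n` with the origin in its (relative) interior. -/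
def simplexF (n : ℕ) : Set (Fin n → ℝ) :=
  convexHull ℝ ((Set.range fun i : Fin n => Pi.single i (1 : ℝ)) ∪ {fun _ => -1})

/-- The Cartesian product `Δ_n × Δ_m`, realized in `ℝ^{n+m}`. -/
def prodP (n m : ℕ) : Set (Fin (n + m) → ℝ) :=
  {z | ∃ a ∈ simplexF n, ∃ b ∈ simplexF m, z = Fin.append a b}

/-- The direct sum `Δ_n ⊕ Δ_m`, realized in `ℝ^{n+m}`. -/
def sumP (n m : ℕ) : Set (Fin (n + m) → ℝ) :=
  convexHull ℝ (((fun a : Fin n → ℝ => Fin.append a (0 : Fin m → ℝ)) '' simplexF n) ∪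
    ((fun b : Fin m → ℝ => Fin.append (0 : Fin n → ℝ) b) '' simplexF m))

/-- The join `A ⋆ B` of two polytopes, realized in `ℝ^{p+q+1}` with the two copies
placed in skew affine subspaces. -/
def joinP {p q : ℕ} (A : Set (Fin p → ℝ)) (B : Set (Fin q → ℝ)) :
    Set (Fin (p + q + 1) → ℝ) :=
  convexHull ℝ
    (((fun a : Fin p → ℝ =>
        Fin.append (Fin.append a (0 : Fin q → ℝ)) (fun _ : Fin 1 => (0 : ℝ))) '' A) ∪
     ((fun b : Fin q → ℝ =>
        Fin.append (Fin.append (0 : Fin p → ℝ) b) (fun _ : Fin 1 => (1 : ℝ))) '' B))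

/-- The canonical `k`-fold iterated pyramid over `X`, realized in `ℝ^{p+k}`. -/
def pyrK {p : ℕ} (k : ℕ) (X : Set (Fin p → ℝ)) : Set (Fin (p + k) → ℝ) :=
  convexHull ℝ (((fun x : Fin p → ℝ => Fin.append x (0 : Fin k → ℝ)) '' X) ∪
    Set.range (fun j : Fin k => Fin.append (0 : Fin p → ℝ) (Pi.single j (1 : ℝ))))

/-- Transport a subset of `ℝ^a` to `ℝ^b` along a proof that `a = b`. -/
def castSet {a b : ℕ} (h : a = b) (X : Set (Fin a → ℝ)) : Set (Fin b → ℝ) :=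
  (fun x : Fin a → ℝ => fun i : Fin b => x (Fin.cast h.symm i)) '' X

/-- Projective equivalence of two subsets of `ℝ^N`: `Q` is the image of `P` under a
projective transformation `x ↦ (A x + b) / (⟨c, x⟩ + δ)` whose associated
`(N+1) × (N+1)` matrix is invertible and whose denominator is positive on `P`. -/
def ProjEquiv {N : ℕ} (P Q : Set (Fin N → ℝ)) : Prop :=
  ∃ (A : (Fin N → ℝ) →ₗ[ℝ] (Fin N → ℝ)) (b c : Fin N → ℝ) (δ : ℝ),
    Function.Bijective
      (fun z : (Fin N → ℝ) × ℝ => (A z.1 + z.2 • b, (∑ i, c i * z.1 i) + δ * z.2)) ∧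
    (∀ x ∈ P, 0 < (∑ i, c i * x i) + δ) ∧
    Q = (fun x : Fin N → ℝ => ((∑ i, c i * x i) + δ)⁻¹ • (A x + b)) '' P

/-- `P` is a pyramid with base `B`: the convex hull of `B` and a point outside
the affine hull of `B`. -/
def IsPyramidOver {N : ℕ} (P B : Set (Fin N → ℝ)) : Prop :=
  ∃ a : Fin N → ℝ, a ∉ affineSpan ℝ B ∧ P = convexHull ℝ (B ∪ {a})

/-- `P` is a `k`-fold iterated pyramid over `B`. -/
def IsKFoldPyramidOver {N : ℕ} : ℕ → Set (Fin N → ℝ) → Set (Fin N → ℝ) → Prop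
  | 0, P, B => P = B
  | k + 1, P, B => ∃ P' : Set (Fin N → ℝ), IsPyramidOver P P' ∧ IsKFoldPyramidOver k P' B

/-- `P` is a pyramid: the convex hull of one of its facets together with one more vertex. -/
def IsPyramidPolytope {N : ℕ} (P : Set (Fin N → ℝ)) : Prop :=
  ∃ (F : Set (Fin N → ℝ)) (v : Fin N → ℝ),
    IsFacetOf F P ∧ IsVertexOf v P ∧ P = convexHull ℝ (F ∪ {v})

/-- A facet is pyramidal if it contains all vertices of the polytope but one. -/
def IsPyramidalFacet {N : ℕ} (F P : Set (Fin N → ℝ)) : Prop :=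
  IsFacetOf F P ∧ ∃ v, IsVertexOf v P ∧ v ∉ F ∧ ∀ w, IsVertexOf w P → w ≠ v → w ∈ F

/-- The projection `π_d : ℝ^{d+1} → ℝ^d` forgetting the last coordinate. -/
def projFun (d : ℕ) : (Fin (d + 1) → ℝ) → (Fin d → ℝ) :=
  fun x i => x i.castSucc

/-- `c` is an outer normal vector exposing the face `F` of `Q`. -/
def IsOuterNormal {N : ℕ} (Q F : Set (Fin N → ℝ)) (c : Fin N → ℝ) : Prop :=
  ∃ b : ℝ, (∀ x ∈ Q, ∑ i, c i * x i ≤ b) ∧ F = {x ∈ Q | ∑ i, c i * x i = b}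

/-- An upper facet: outer normal with positive last coordinate. -/
def IsUpperFacet {d : ℕ} (F Q : Set (Fin (d + 1) → ℝ)) : Prop :=
  IsFacetOf F Q ∧ ∃ c, IsOuterNormal Q F c ∧ 0 < c (Fin.last d)

/-- A lower facet: outer normal with negative last coordinate. -/
def IsLowerFacet {d : ℕ} (F Q : Set (Fin (d + 1) → ℝ)) : Prop :=
  IsFacetOf F Q ∧ ∃ c, IsOuterNormal Q F c ∧ c (Fin.last d) < 0

/-- A vertical facet: every outer normal has vanishing last coordinate. -/
def IsVerticalFacet {d : ℕ} (F Q : Set (Fin (d + 1) → ℝ)) : Prop :=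
  IsFacetOf F Q ∧ ∀ c, IsOuterNormal Q F c → c (Fin.last d) = 0

/-- An equatorial ridge: a ridge that is the intersection of an upper and a lower facet. -/
def IsEquatorialRidge {d : ℕ} (F Q : Set (Fin (d + 1) → ℝ)) : Prop :=
  IsRidgeOf F Q ∧ ∃ F₁ F₂ : Set (Fin (d + 1) → ℝ),
    IsUpperFacet F₁ Q ∧ IsLowerFacet F₂ Q ∧ F = F₁ ∩ F₂

/-- A face `F` of `Q` is preserved under the projection forgetting the last coordinate. -/
def PreservedFace {d : ℕ} (Q F : Set (Fin (d + 1) → ℝ)) : Prop :=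
  IsFaceOf (projFun d '' F) (projFun d '' Q) ∧ projFun d ⁻¹' (projFun d '' F) ∩ Q = F

/-- A face `F` of `Q` is strictly preserved: preserved and of the same dimension as its image. -/
def StrictlyPreservedFace {d : ℕ} (Q F : Set (Fin (d + 1) → ℝ)) : Prop :=
  PreservedFace Q F ∧ pdim (projFun d '' F) = pdim F

/-- A hexagon: a 2-dimensional polytope with exactly 6 vertices. -/
def IsHexagon {N : ℕ} (P : Set (Fin N → ℝ)) : Prop :=
  IsPolytope P ∧ pdim P = 2 ∧ vertexCount P = 6

/-- Three lines are concurrent: they share a common point, or they are pairwise parallel. -/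
def ConcurrentLines {N : ℕ} (L₁ L₂ L₃ : AffineSubspace ℝ (Fin N → ℝ)) : Prop :=
  (∃ x, x ∈ L₁ ∧ x ∈ L₂ ∧ x ∈ L₃) ∨
    (AffineSubspace.Parallel L₁ L₂ ∧ AffineSubspace.Parallel L₂ L₃ ∧
      AffineSubspace.Parallel L₁ L₃)

/-- A cyclic labeling of the vertices of a hexagon: consecutive points are joined by edges. -/
def CyclicLabeling {N : ℕ} (P : Set (Fin N → ℝ)) (p : Fin 6 → (Fin N → ℝ)) : Prop :=
  Function.Injective p ∧ Set.range p = vertexSet P ∧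
    ∀ i : Fin 6, IsFaceOf (segment ℝ (p i) (p (i + 1))) P

/-- A Desarguian hexagon. -/
def Desarguian {N : ℕ} (P : Set (Fin N → ℝ)) : Prop :=
  ∃ p : Fin 6 → (Fin N → ℝ), CyclicLabeling P p ∧
    ConcurrentLines (affineSpan ℝ {p 0, p 1}) (affineSpan ℝ {p 5, p 2})
      (affineSpan ℝ {p 3, p 4})

/-- A polytope is simplicial if every facet is a simplex. -/
def IsSimplicial {N : ℕ} (P : Set (Fin N → ℝ)) : Prop :=
  ∀ F : Set (Fin N → ℝ), IsFacetOf F P →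
    ∃ S : Finset (Fin N → ℝ),
      AffineIndependent ℝ (Subtype.val : {x // x ∈ S} → (Fin N → ℝ)) ∧
      F = convexHull ℝ (S : Set (Fin N → ℝ))

section Homogenization

variable {N : ℕ}

/-- The embedding of `ℝ^N` as the affine hyperplane at height one in `ℝ^N × ℝ`. -/
def homog (x : Fin N → ℝ) : (Fin N → ℝ) × ℝ := (x, 1)

/-- The linear span of the homogenization of a set. -/
def homogSpan (X : Set (Fin N → ℝ)) : Submodule ℝ ((Fin N → ℝ) × ℝ) :=
  Submodule.span ℝ (homog '' X)

/-- The rank of a set, that is, the dimension of its affine hull plus one. -/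
def homogRank (X : Set (Fin N → ℝ)) : ℕ := Module.finrank ℝ (homogSpan X)

lemma homog_combo {a b : ℝ} (h : a + b = 1) (x y : Fin N → ℝ) :
    homog (a • x + b • y) = a • homog x + b • homog y := by
  simp [homog, h]

lemma homog_mem_homogSpan {X : Set (Fin N → ℝ)} {x : Fin N → ℝ} (hx : x ∈ X) :
    homog x ∈ homogSpan X :=
  Submodule.subset_span (mem_image_of_mem _ hx)

lemma homogSpan_mono {X Y : Set (Fin N → ℝ)} (h : X ⊆ Y) : homogSpan X ≤ homogSpan Y :=
  Submodule.span_mono (image_mono h)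

lemma homogRank_mono {X Y : Set (Fin N → ℝ)} (h : X ⊆ Y) : homogRank X ≤ homogRank Y :=
  Submodule.finrank_mono (homogSpan_mono h)

lemma homogRank_empty : homogRank (∅ : Set (Fin N → ℝ)) = 0 := by
  rw [homogRank, homogSpan, image_empty, Submodule.span_empty, finrank_bot]

lemma homogRank_le (X : Set (Fin N → ℝ)) : homogRank X ≤ N + 1 := by
  simpa [homogRank] using (homogSpan X).finrank_le

lemma homogSpan_convexHull (X : Set (Fin N → ℝ)) :
    homogSpan (convexHull ℝ X) = homogSpan X := by
  refine le_antisymm (Submodule.span_le.2 ?_) (homogSpan_mono (subset_convexHull ℝ X))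
  rintro _ ⟨x, hx, rfl⟩
  refine convexHull_min (t := {x | homog x ∈ homogSpan X})
    (fun y hy => homog_mem_homogSpan hy) ?_ hx
  intro y hy z hz a b _ _ hab
  simpa only [mem_ofPred_eq, homog_combo hab] using
    add_mem (Submodule.smul_mem _ a hy) (Submodule.smul_mem _ b hz)

lemma homogRank_convexHull (X : Set (Fin N → ℝ)) :
    homogRank (convexHull ℝ X) = homogRank X := by
  rw [homogRank, homogSpan_convexHull, homogRank]

lemma homogRank_eq_pdim_add_one (X : Set (Fin N → ℝ)) : (homogRank X : ℤ) = pdim X + 1 := by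
  rcases X.eq_empty_or_nonempty with rfl | ⟨p, hp⟩
  · simp [homogRank_empty, pdim]
  have hpd : pdim X = Module.finrank ℝ (vectorSpan ℝ X) := by
    rw [pdim, if_pos ⟨p, hp⟩, direction_affineSpan]
  have hlift : ∀ v ∈ vectorSpan ℝ X, ((v, 0) : (Fin N → ℝ) × ℝ) ∈ homogSpan X := by
    intro v hv
    rw [vectorSpan_eq_span_vsub_set_right ℝ hp] at hv
    refine Submodule.span_induction (p := fun v _ => ((v, 0) : (Fin N → ℝ) × ℝ) ∈ homogSpan X)
      ?_ (zero_mem _) ?_ ?_ hv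
    · rintro _ ⟨x, hx, rfl⟩
      have := sub_mem (homog_mem_homogSpan hx) (homog_mem_homogSpan hp)
      simpa [homog] using this
    · intro x y _ _ hx hy
      simpa using add_mem hx hy
    · intro a x _ hx
      simpa using Submodule.smul_mem _ a hx
  let g : vectorSpan ℝ X × ℝ →ₗ[ℝ] (Fin N → ℝ) × ℝ :=
    (LinearMap.prodMap (Submodule.subtype _) LinearMap.id) +
      (LinearMap.toSpanSingleton ℝ _ (p, 0)) ∘ₗ LinearMap.snd ℝ _ _
  have hg : ∀ v t, g (v, t) = ((v : Fin N → ℝ) + t • p, t) := by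
    intro v t; simp [g]
  have hinj : Function.Injective g := by
    rintro ⟨v, t⟩ ⟨w, s⟩ h
    rw [hg, hg, Prod.mk.injEq] at h
    obtain ⟨h₁, rfl⟩ := h
    simpa using h₁
  have hrange : LinearMap.range g = homogSpan X := by
    refine le_antisymm ?_ (Submodule.span_le.2 ?_)
    · rintro _ ⟨⟨v, t⟩, rfl⟩
      rw [hg]
      have := add_mem (hlift v v.2) (Submodule.smul_mem _ t (homog_mem_homogSpan hp))
      simpa [homog] using this
    · rintro _ ⟨x, hx, rfl⟩
      exact ⟨(⟨x - p, vsub_mem_vectorSpan ℝ hx hp⟩, 1), by simp [hg, homog]⟩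
  rw [homogRank, ← hrange, LinearMap.finrank_range_of_inj hinj, hpd]
  simp

lemma isFaceOf_iff {F P : Set (Fin N → ℝ)} :
    IsFaceOf F P ↔ ∃ f : (Fin N → ℝ) × ℝ →ₗ[ℝ] ℝ,
      (∀ x ∈ P, f (homog x) ≤ 0) ∧ F = {x ∈ P | f (homog x) = 0} := by
  constructor
  · rintro ⟨c, b, hb, rfl⟩
    let f : (Fin N → ℝ) × ℝ →ₗ[ℝ] ℝ :=
      (Fintype.linearCombination ℝ c) ∘ₗ LinearMap.fst ℝ _ _ - b • LinearMap.snd ℝ _ _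
    have hf : ∀ x, f (homog x) = ∑ i, c i * x i - b := by
      intro x
      simp [f, homog, Fintype.linearCombination_apply, mul_comm]
    refine ⟨f, fun x hx => ?_, ?_⟩
    · rw [hf]; linarith [hb x hx]
    · ext x; simp [hf, sub_eq_zero]
  · rintro ⟨f, hf, rfl⟩
    have key : ∀ x, f (homog x) = ∑ i, f (Pi.single i 1, 0) * x i + f (0, 1) := by
      intro x
      have h₁ : homog x = LinearMap.inl ℝ (Fin N → ℝ) ℝ x + (0, 1) := by simp [homog]
      have h₂ := LinearMap.pi_apply_eq_sum_univ (f ∘ₗ LinearMap.inl ℝ (Fin N → ℝ) ℝ) x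
      rw [h₁, map_add, ← LinearMap.comp_apply, h₂]
      congr 1
      refine Finset.sum_congr rfl fun i _ => ?_
      have h₃ : (fun j => if i = j then (1 : ℝ) else 0) = Pi.single i 1 := by
        ext j; simp [Pi.single_apply, eq_comm]
      simp [h₃, mul_comm]
    refine ⟨fun i => f (Pi.single i 1, 0), -f (0, 1), fun x hx => ?_, ?_⟩
    · linarith [key x, hf x hx]
    · ext x
      simp only [mem_ofPred_eq, key x]
      exact and_congr_right fun _ => ⟨fun h => by linarith, fun h => by linarith⟩

lemma apply_homog_nonpos_of_mem_convexHull {f : (Fin N → ℝ) × ℝ →ₗ[ℝ] ℝ}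
    {T : Set (Fin N → ℝ)} (h : ∀ x ∈ T, f (homog x) ≤ 0) :
    ∀ x ∈ convexHull ℝ T, f (homog x) ≤ 0 := by
  intro x hx
  refine convexHull_min (t := {x | f (homog x) ≤ 0}) h ?_ hx
  intro y hy z hz a b ha hb hab
  simp only [mem_ofPred_eq, homog_combo hab, map_add, map_smul, smul_eq_mul] at *
  nlinarith

lemma setOf_mem_convexHull_eq_zero {f : (Fin N → ℝ) × ℝ →ₗ[ℝ] ℝ}
    {T : Set (Fin N → ℝ)} (h : ∀ x ∈ T, f (homog x) ≤ 0) :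
    {x ∈ convexHull ℝ T | f (homog x) = 0} = convexHull ℝ {x ∈ T | f (homog x) = 0} := by
  have hzero : ∀ x ∈ convexHull ℝ {x ∈ T | f (homog x) = 0}, f (homog x) = 0 := by
    intro x hx
    refine convexHull_min (t := {x | f (homog x) = 0}) (fun y hy => hy.2) ?_ hx
    intro y hy z hz a b ha hb hab
    simp only [mem_ofPred_eq, homog_combo hab, map_add, map_smul, smul_eq_mul] at *
    simp [hy, hz]
  apply Subset.antisymm
  · rintro x ⟨hx, hx0⟩
    have : x ∈ {x | f (homog x) < 0 ∨ x ∈ convexHull ℝ {x ∈ T | f (homog x) = 0}} := by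
      refine convexHull_min ?_ ?_ hx
      · intro y hy
        rcases (h y hy).lt_or_eq with h' | h'
        · exact Or.inl h'
        · exact Or.inr (subset_convexHull ℝ _ ⟨hy, h'⟩)
      · rw [convex_iff_forall_pos]
        intro y hy z hz a b ha hb hab
        simp only [mem_ofPred_eq, homog_combo hab, map_add, map_smul, smul_eq_mul] at *
        rcases hy with hy | hy <;> rcases hz with hz | hz
        · left; nlinarith
        · left; rw [hzero z hz]; nlinarith
        · left; rw [hzero y hy]; nlinarith
        · exact Or.inr (convex_convexHull ℝ _ hy hz ha.le hb.le hab)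
    rcases this with h' | h'
    · exact absurd hx0 h'.ne
    · exact h'
  · exact fun x hx => ⟨convexHull_mono (fun y hy => hy.1) hx, hzero x hx⟩

lemma isFaceOf_empty (P : Set (Fin N → ℝ)) : IsFaceOf ∅ P :=
  ⟨0, 1, by simp, by simp⟩

lemma isFaceOf_self (P : Set (Fin N → ℝ)) : IsFaceOf P P :=
  ⟨0, 0, by simp, by simp⟩

lemma homogRank_lt_of_isFaceOf {F G P : Set (Fin N → ℝ)} (hG : IsFaceOf G P)
    (hF : IsFaceOf F P) (h : G ⊂ F) : homogRank G < homogRank F := by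
  obtain ⟨f, -, rfl⟩ := isFaceOf_iff.1 hG
  obtain ⟨z, hz, hzG⟩ := exists_of_ssubset h
  obtain ⟨_, _, _, rfl⟩ := hF
  refine Submodule.finrank_lt_finrank_of_lt
    (SetLike.lt_iff_le_and_exists.2 ⟨homogSpan_mono h.1, homog z, homog_mem_homogSpan hz, ?_⟩)
  intro hmem
  have hle : homogSpan {x ∈ P | f (homog x) = 0} ≤ LinearMap.ker f := by
    refine Submodule.span_le.2 ?_
    rintro _ ⟨x, hx, rfl⟩
    exact hx.2
  exact hzG ⟨hz.1, hle hmem⟩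

end Homogenization

section FaceRank

variable {M N : ℕ}

/-- A linear functional can be made negative on the finitely many points where a nonpositive
functional is negative by adding a large multiple of the latter. -/
lemma exists_add_smul_neg {E : Type*} [AddCommGroup E] [Module ℝ E] {T : Set E} (hT : T.Finite)
    (f g : E →ₗ[ℝ] ℝ) :
    ∃ K : ℝ, ∀ v ∈ T, f v < 0 → (g + K • f) v < 0 := by
  obtain ⟨K, hK⟩ := (hT.image fun v => g v / (-f v)).bddAbove
  refine ⟨K + 1, fun v hv hfv => ?_⟩
  have h := hK (mem_image_of_mem (fun v => g v / (-f v)) hv)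
  have h' : g v ≤ K * (-f v) := (div_le_iff₀ (neg_pos.2 hfv)).1 h
  simp only [LinearMap.add_apply, LinearMap.smul_apply, smul_eq_mul]
  linarith

/-- Between two faces of a polytope whose dimensions differ by at least two there is
another face. -/
lemma IsFaceOf.exists_between {T : Set (Fin N → ℝ)} (hT : T.Finite) {F G : Set (Fin N → ℝ)}
    (hF : IsFaceOf F (convexHull ℝ T)) (hG : IsFaceOf G (convexHull ℝ T)) (hGF : G ⊂ F)
    (hrank : homogRank G + 1 < homogRank F) :
    ∃ H, IsFaceOf H (convexHull ℝ T) ∧ G ⊂ H ∧ H ⊂ F := by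
  obtain ⟨f, hf, rfl⟩ := isFaceOf_iff.1 hF
  obtain ⟨g, hg, rfl⟩ := isFaceOf_iff.1 hG
  have hfT : ∀ x ∈ T, f (homog x) ≤ 0 := fun x hx => hf x (subset_convexHull ℝ T hx)
  have hgT : ∀ x ∈ T, g (homog x) ≤ 0 := fun x hx => hg x (subset_convexHull ℝ T hx)
  obtain ⟨x₀, hx₀, hx₀G⟩ := exists_of_ssubset hGF
  have hgx₀ : g (homog x₀) < 0 := (hg x₀ hx₀.1).lt_of_ne fun h => hx₀G ⟨hx₀.1, h⟩
  set W := homogSpan {x ∈ convexHull ℝ T | g (homog x) = 0} ⊔ Submodule.span ℝ {homog x₀} with hW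
  obtain ⟨y, hy, hyW⟩ : ∃ y ∈ {x ∈ T | f (homog x) = 0}, homog y ∉ W := by
    by_contra! hcon
    have hle : homogSpan {x ∈ convexHull ℝ T | f (homog x) = 0} ≤ W := by
      rw [setOf_mem_convexHull_eq_zero hfT, homogSpan_convexHull]
      refine Submodule.span_le.2 ?_
      rintro _ ⟨x, hx, rfl⟩
      exact hcon x hx
    have h₁ := Submodule.finrank_mono hle
    have h₂ := Submodule.finrank_add_le_finrank_add_finrank
      (homogSpan {x ∈ convexHull ℝ T | g (homog x) = 0}) (Submodule.span ℝ {homog x₀})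
    have h₃ : Module.finrank ℝ (Submodule.span ℝ {homog x₀}) ≤ 1 := by
      simpa using finrank_span_le_card (R := ℝ) ({homog x₀} : Set ((Fin N → ℝ) × ℝ))
    rw [← hW] at h₂
    simp only [homogRank] at hrank
    omega
  obtain ⟨m, hmW, hmy⟩ : ∃ m : (Fin N → ℝ) × ℝ →ₗ[ℝ] ℝ, (∀ w ∈ W, m w = 0) ∧ 0 < m (homog y) := by
    obtain ⟨m, hm, hmW⟩ := Submodule.exists_le_ker_of_notMem hyW
    rcases hm.lt_or_gt with h | h
    · exact ⟨-m, fun w hw => by simp [LinearMap.mem_ker.1 (hmW hw)], by simpa using h⟩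
    · exact ⟨m, fun w hw => hmW hw, h⟩
  have hmG : ∀ x ∈ convexHull ℝ T, g (homog x) = 0 → m (homog x) = 0 := fun x hx hgx =>
    hmW _ (Submodule.mem_sup_left (homog_mem_homogSpan ⟨hx, hgx⟩))
  have hmx₀ : m (homog x₀) = 0 :=
    hmW _ (Submodule.mem_sup_right (Submodule.mem_span_singleton_self _))
  have hfin : {x ∈ T | f (homog x) = 0 ∧ 0 < m (homog x)}.Finite := hT.subset fun x hx => hx.1
  obtain ⟨v, hv, hvmin⟩ := exists_min_image _ (fun x => -g (homog x) / m (homog x)) hfin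
    ⟨y, hy.1, hy.2, hmy⟩
  set t := -g (homog v) / m (homog v) with ht
  have ht0 : 0 ≤ t := div_nonneg (neg_nonneg.2 (hgT v hv.1)) hv.2.2.le
  have htv : g (homog v) + t * m (homog v) = 0 := by
    rw [ht, div_mul_cancel₀ _ hv.2.2.ne']; ring
  obtain ⟨K, hK⟩ := exists_add_smul_neg (hT.image homog) f (g + t • m)
  have hval : ∀ x, (g + t • m + K • f) (homog x) =
      g (homog x) + t * m (homog x) + K * f (homog x) := fun x => by simp
  have hneg : ∀ x ∈ T, (g + t • m + K • f) (homog x) ≤ 0 := by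
    intro x hx
    rcases (hfT x hx).lt_or_eq with h | h
    · exact (hK _ (mem_image_of_mem _ hx) h).le
    · rw [hval, h, mul_zero, add_zero]
      rcases le_or_gt (m (homog x)) 0 with h' | h'
      · nlinarith [hgT x hx]
      · have := (le_div_iff₀ h').1 (hvmin x ⟨hx, h, h'⟩)
        linarith
  refine ⟨{x ∈ convexHull ℝ T | (g + t • m + K • f) (homog x) = 0},
    isFaceOf_iff.2 ⟨_, apply_homog_nonpos_of_mem_convexHull hneg, rfl⟩, ?_, ?_⟩
  · refine ssubset_iff_exists.2 ⟨fun x hx => ⟨hx.1, ?_⟩, v, ⟨subset_convexHull ℝ T hv.1, ?_⟩, ?_⟩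
    · rw [hval, hx.2, hmG x hx.1 hx.2, (hGF.1 hx).2]; ring
    · rw [hval, hv.2.1, htv]; ring
    · exact fun h => hv.2.2.ne' (hmG v h.1 h.2)
  · refine ssubset_iff_exists.2 ⟨?_, x₀, hx₀, ?_⟩
    · rw [setOf_mem_convexHull_eq_zero hneg, setOf_mem_convexHull_eq_zero hfT]
      refine convexHull_mono fun x hx => ⟨hx.1, ?_⟩
      by_contra hne
      exact (hK _ (mem_image_of_mem _ hx.1) ((hfT x hx.1).lt_of_ne hne)).ne hx.2
    · rintro ⟨-, h⟩
      rw [hval, hx₀.2, hmx₀] at h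
      linarith

/-- Every nonempty face of a polytope covers another face. -/
lemma IsFaceOf.exists_facet {T : Set (Fin N → ℝ)} (hT : T.Finite) {F : Set (Fin N → ℝ)}
    (hF : IsFaceOf F (convexHull ℝ T)) (hne : F.Nonempty) :
    ∃ G, IsFaceOf G (convexHull ℝ T) ∧ G ⊂ F ∧ homogRank F ≤ homogRank G + 1 := by
  classical
  set p : ℕ → Prop := fun n => ∃ G, IsFaceOf G (convexHull ℝ T) ∧ G ⊂ F ∧ homogRank G = n
  have h₀ : p 0 := ⟨∅, isFaceOf_empty _, hne.empty_ssubset, homogRank_empty⟩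
  obtain ⟨G, hG, hGF, hGn⟩ := Nat.findGreatest_spec (Nat.zero_le (N + 1)) h₀
  refine ⟨G, hG, hGF, ?_⟩
  by_contra! hlt
  obtain ⟨H, hH, hGH, hHF⟩ := hF.exists_between hT hG hGF hlt
  have h₁ := homogRank_lt_of_isFaceOf hG hH hGH
  have h₂ : homogRank H ≤ Nat.findGreatest p (N + 1) :=
    Nat.le_findGreatest (homogRank_le H) ⟨H, hH, hHF, rfl⟩
  omega

lemma combEquiv_iff {P : Set (Fin M → ℝ)} {Q : Set (Fin N → ℝ)} :
    CombEquiv P Q ↔ Nonempty ({F // IsFaceOf F P} ≃o {G // IsFaceOf G Q}) :=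
  ⟨fun ⟨φ, h⟩ => ⟨⟨φ, fun {a b} => (h a b).symm⟩⟩,
    fun ⟨φ⟩ => ⟨φ.toEquiv, fun a b => (φ.le_iff_le (x := a) (y := b)).symm⟩⟩

/-- An isomorphism of face lattices does not decrease the dimension of the faces of a polytope. -/
lemma homogRank_le_of_orderIso {T : Set (Fin M → ℝ)} (hT : T.Finite) {Q : Set (Fin N → ℝ)}
    (φ : {F // IsFaceOf F (convexHull ℝ T)} ≃o {G // IsFaceOf G Q})
    (F : {F // IsFaceOf F (convexHull ℝ T)}) : homogRank F.1 ≤ homogRank (φ F).1 := by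
  induction hn : homogRank F.1 using Nat.strong_induction_on generalizing F with
  | _ n ih =>
    subst hn
    rcases F.1.eq_empty_or_nonempty with h | h
    · rw [h, homogRank_empty]; exact Nat.zero_le _
    · obtain ⟨G, hG, hGF, hr⟩ := F.2.exists_facet hT h
      have h₁ := ih _ (homogRank_lt_of_isFaceOf hG F.2 hGF) ⟨G, hG⟩ rfl
      have hlt : φ ⟨G, hG⟩ < φ F := φ.lt_iff_lt.2 hGF
      have h₂ := homogRank_lt_of_isFaceOf (φ ⟨G, hG⟩).2 (φ F).2 hlt
      exact hr.trans (Nat.succ_le_of_lt (h₁.trans_lt h₂))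

end FaceRank

section IteratedPyramid

variable {M N k : ℕ}

/-- The faces of an injective linear image of a set. -/
def faceImageOrderIso (i : (Fin M → ℝ) →ₗ[ℝ] (Fin N → ℝ)) (π : (Fin N → ℝ) →ₗ[ℝ] (Fin M → ℝ))
    (h : ∀ x, π (i x) = x) (X : Set (Fin M → ℝ)) :
    {F // IsFaceOf F X} ≃o {G // IsFaceOf G (i '' X)} where
  toFun F := ⟨i '' F.1, by
    obtain ⟨f, hf, hF⟩ := isFaceOf_iff.1 F.2
    have hpi : ∀ x, (f ∘ₗ π.prodMap LinearMap.id) (homog (i x)) = f (homog x) := fun x => by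
      simp [homog, h]
    refine isFaceOf_iff.2 ⟨f ∘ₗ π.prodMap LinearMap.id, ?_, ?_⟩
    · rintro _ ⟨x, hx, rfl⟩
      exact (hpi x).trans_le (hf x hx)
    · rw [hF]
      ext y
      constructor
      · rintro ⟨x, hx, rfl⟩
        exact ⟨mem_image_of_mem _ hx.1, (hpi x).trans hx.2⟩
      · rintro ⟨⟨x, hx, rfl⟩, hy⟩
        exact ⟨x, ⟨hx, (hpi x).symm.trans hy⟩, rfl⟩⟩
  invFun G := ⟨i ⁻¹' G.1, by
    obtain ⟨g, hg, hG⟩ := isFaceOf_iff.1 G.2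
    have hi : Function.Injective i := Function.LeftInverse.injective h
    have hgi : ∀ x, (g ∘ₗ i.prodMap LinearMap.id) (homog x) = g (homog (i x)) := fun x => by
      simp [homog]
    refine isFaceOf_iff.2 ⟨g ∘ₗ i.prodMap LinearMap.id, fun x hx => ?_, ?_⟩
    · exact (hgi x).trans_le (hg _ (mem_image_of_mem _ hx))
    · rw [hG]
      ext x
      rw [mem_preimage, mem_ofPred_eq, mem_ofPred_eq, hi.mem_set_image, hgi]⟩
  left_inv F := Subtype.ext
    (preimage_image_eq _ (Function.LeftInverse.injective h))
  right_inv G := Subtype.ext <| by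
    obtain ⟨_, _, hG⟩ := G.2
    refine image_preimage_eq_of_subset ?_
    rw [hG.2]
    exact fun x hx => image_subset_range _ _ hx.1
  map_rel_iff' {F G} := image_subset_image_iff (Function.LeftInverse.injective h)

/-- The faces of an iterated pyramid are the joins of a face of the base with a subset of the
apices.  The functionals `h j` express that the apices are independent of the base. -/
def pyramidFaceOrderIso (A : Set (Fin N → ℝ)) (r : Fin k → Fin N → ℝ)
    (h : Fin k → (Fin N → ℝ) × ℝ →ₗ[ℝ] ℝ) (hA : ∀ j, ∀ x ∈ A, h j (homog x) = 0)
    (hr : ∀ i j, h j (homog (r i)) = if i = j then 1 else 0) :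
    {G // IsFaceOf G (convexHull ℝ (A ∪ range r))} ≃o {F // IsFaceOf F A} × Set (Fin k) := by
  have hext : ∀ (F : Set (Fin N → ℝ)) (J : Set (Fin k)), IsFaceOf F A →
      ∃ f : (Fin N → ℝ) × ℝ →ₗ[ℝ] ℝ, (∀ x ∈ A ∪ range r, f (homog x) ≤ 0) ∧
        {x ∈ A | f (homog x) = 0} = F ∧ {j | f (homog (r j)) = 0} = J := by
    classical
    rintro F J hF
    obtain ⟨f, hf, rfl⟩ := isFaceOf_iff.1 hF
    set g := f - ∑ j, (f (homog (r j)) + if j ∈ J then 0 else 1) • h j with hg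
    have hgA : ∀ x ∈ A, g (homog x) = f (homog x) := by
      intro x hx
      simp [hg, LinearMap.sum_apply, hA _ x hx]
    have hgr : ∀ j, g (homog (r j)) = -(if j ∈ J then 0 else 1) := by
      intro j
      simp [hg, LinearMap.sum_apply, hr]
    refine ⟨g, ?_, ?_, ?_⟩
    · rintro x (hx | ⟨j, rfl⟩)
      · rw [hgA x hx]; exact hf x hx
      · rw [hgr]; split_ifs <;> norm_num
    · ext x
      exact and_congr_right fun hx => by rw [hgA x hx]
    · ext j
      rw [mem_ofPred_eq, hgr]
      by_cases hj : j ∈ J <;> simp [hj]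
  have hsep : ∀ f : (Fin N → ℝ) × ℝ →ₗ[ℝ] ℝ, {x ∈ A ∪ range r | f (homog x) = 0} =
      {x ∈ A | f (homog x) = 0} ∪ r '' {j | f (homog (r j)) = 0} := by
    intro f
    ext x
    constructor
    · rintro ⟨hx | ⟨j, rfl⟩, h0⟩
      · exact Or.inl ⟨hx, h0⟩
      · exact Or.inr ⟨j, h0, rfl⟩
    · rintro (hx | ⟨j, hj, rfl⟩)
      · exact ⟨Or.inl hx.1, hx.2⟩
      · exact ⟨Or.inr ⟨j, rfl⟩, hj⟩
  have hsub : A ∪ range r ⊆ convexHull ℝ (A ∪ range r) := subset_convexHull ℝ _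
  have hrec : ∀ G, IsFaceOf G (convexHull ℝ (A ∪ range r)) →
      convexHull ℝ ((G ∩ A) ∪ r '' {j | r j ∈ G}) = G := by
    intro G hG
    obtain ⟨f, hf, rfl⟩ := isFaceOf_iff.1 hG
    conv_rhs => rw [setOf_mem_convexHull_eq_zero fun x hx => hf x (hsub hx), hsep]
    refine congrArg (convexHull ℝ) (congrArg₂ (· ∪ ·) ?_ (congrArg (r '' ·) ?_))
    · ext x
      exact ⟨fun hx => ⟨hx.2, hx.1.2⟩, fun hx => ⟨⟨hsub (Or.inl hx.1), hx.2⟩, hx.1⟩⟩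
    · ext j
      exact ⟨fun hj => hj.2, fun hj => ⟨hsub (Or.inr ⟨j, rfl⟩), hj⟩⟩
  refine
    { toFun := fun G => (⟨G.1 ∩ A, ?_⟩, {j | r j ∈ G.1})
      invFun := fun FJ => ⟨convexHull ℝ (FJ.1.1 ∪ r '' FJ.2), ?_⟩
      left_inv := fun G => Subtype.ext (hrec G.1 G.2)
      right_inv := fun FJ => ?_
      map_rel_iff' := fun {G₁ G₂} => ⟨fun hle => ?_, fun hle => ?_⟩ }
  · obtain ⟨f, hf, hG⟩ := isFaceOf_iff.1 G.2
    refine isFaceOf_iff.2 ⟨f, fun x hx => hf x (hsub (Or.inl hx)), ?_⟩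
    rw [hG]
    ext x
    exact ⟨fun hx => ⟨hx.2, hx.1.2⟩, fun hx => ⟨⟨hsub (Or.inl hx.1), hx.2⟩, hx.1⟩⟩
  · obtain ⟨f, hf, hF, hJ⟩ := hext FJ.1.1 FJ.2 FJ.1.2
    refine isFaceOf_iff.2 ⟨f, apply_homog_nonpos_of_mem_convexHull hf, ?_⟩
    rw [setOf_mem_convexHull_eq_zero hf, hsep, hF, hJ]
  · obtain ⟨⟨F, hFA⟩, J⟩ := FJ
    obtain ⟨f, hf, rfl, rfl⟩ := hext F J hFA
    refine Prod.ext (Subtype.ext ?_) ?_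
    · simp only [← hsep, ← setOf_mem_convexHull_eq_zero hf]
      ext x
      exact ⟨fun hx => ⟨hx.2, hx.1.2⟩, fun hx => ⟨⟨hsub (Or.inl hx.1), hx.2⟩, hx.1⟩⟩
    · simp only [← hsep, ← setOf_mem_convexHull_eq_zero hf]
      ext j
      exact ⟨fun hj => hj.2, fun hj => ⟨hsub (Or.inr ⟨j, rfl⟩), hj⟩⟩
  · change G₁.1 ⊆ G₂.1
    rw [← hrec G₁.1 G₁.2, ← hrec G₂.1 G₂.2]
    exact convexHull_mono (union_subset_union hle.1 (image_mono hle.2))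
  · exact ⟨inter_subset_inter_left A hle, fun j hj => hle hj⟩

lemma convexHull_convexHull_union (S B : Set (Fin N → ℝ)) :
    convexHull ℝ (convexHull ℝ S ∪ B) = convexHull ℝ (S ∪ B) := by
  refine Subset.antisymm (convexHull_min (union_subset ?_ ?_) (convex_convexHull ℝ _))
    (convexHull_mono (union_subset_union_left _ (subset_convexHull ℝ _)))
  · exact convexHull_mono subset_union_left
  · exact subset_union_right.trans (subset_convexHull ℝ _)

/-- Adding `k` independent apices to a set that is combinatorially equivalent to `X` yields a
set that is combinatorially equivalent to the `k`-fold pyramid over `X`. -/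
lemma CombEquiv.pyrK {A : Set (Fin N → ℝ)} {X : Set (Fin M → ℝ)} (hAX : CombEquiv A X)
    (r : Fin k → Fin N → ℝ) (h : Fin k → (Fin N → ℝ) × ℝ →ₗ[ℝ] ℝ)
    (hA : ∀ j, ∀ x ∈ A, h j (homog x) = 0)
    (hr : ∀ i j, h j (homog (r i)) = if i = j then 1 else 0) :
    CombEquiv (convexHull ℝ (A ∪ range r)) (pyrK k X) := by
  obtain ⟨φ⟩ := combEquiv_iff.1 hAX
  let i : (Fin M → ℝ) →ₗ[ℝ] (Fin (M + k) → ℝ) :=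
    { toFun := fun x => Fin.append x 0
      map_add' := fun x y => by
        ext l; refine Fin.addCases (fun l => ?_) (fun l => ?_) l <;> simp
      map_smul' := fun a x => by
        ext l; refine Fin.addCases (fun l => ?_) (fun l => ?_) l <;> simp }
  let ψ := φ.trans (faceImageOrderIso i (LinearMap.funLeft ℝ ℝ (Fin.castAdd k))
    (fun x => by ext l; simp [i, LinearMap.funLeft_apply]) X)
  let χ := pyramidFaceOrderIso (i '' X)
    (fun j : Fin k => Fin.append (0 : Fin M → ℝ) (Pi.single j (1 : ℝ)))
    (fun j => LinearMap.proj (Fin.natAdd M j) ∘ₗ LinearMap.fst ℝ _ _)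
    (by rintro j _ ⟨x, -, rfl⟩; simp [i, homog])
    (by intro a b; simp [homog, Pi.single_apply, eq_comm])
  let ω : {F // IsFaceOf F A} × Set (Fin k) ≃o {F // IsFaceOf F (i '' X)} × Set (Fin k) :=
    { toEquiv := ψ.toEquiv.prodCongr (Equiv.refl _)
      map_rel_iff' := fun {a b} => and_congr ψ.le_iff_le Iff.rfl }
  exact combEquiv_iff.2 ⟨((pyramidFaceOrderIso A r h hA hr).trans ω).trans χ.symm⟩

end IteratedPyramid

section Prism

lemma mem_simplexF_one {s : ℝ} (h₁ : -1 ≤ s) (h₂ : s ≤ 1) : ![s] ∈ simplexF 1 := by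
  have h : ![s] = ((1 + s) / 2) • Pi.single 0 1 +
      ((1 - s) / 2) • (fun _ => -1) := by
    ext j; fin_cases j; simp; ring
  have hconv : Convex ℝ (simplexF 1) := convex_convexHull ℝ _
  rw [h]
  refine hconv (subset_convexHull ℝ _ (Or.inl ⟨0, rfl⟩))
    (subset_convexHull ℝ _ (Or.inr rfl)) ?_ ?_ ?_ <;> linarith

lemma le_one_of_mem_simplexF_one {x : Fin 1 → ℝ} (hx : x ∈ simplexF 1) : x 0 ≤ 1 := by
  refine convexHull_min (t := {x | x 0 ≤ 1}) ?_ ?_ hx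
  · rintro _ (⟨i, rfl⟩ | rfl)
    · fin_cases i; simp
    · simp
  · intro y hy z hz a b ha hb hab
    simp only [mem_ofPred_eq, Pi.add_apply, Pi.smul_apply, smul_eq_mul] at *
    nlinarith

lemma le_one_of_mem_simplexF_two {x : Fin 2 → ℝ} (hx : x ∈ simplexF 2) :
    x 0 + x 1 ≤ 1 ∧ x 0 - 2 * x 1 ≤ 1 := by
  refine convexHull_min
    (t := {x | x 0 + x 1 ≤ 1 ∧ x 0 - 2 * x 1 ≤ 1}) ?_ ?_ hx
  · rintro _ (⟨i, rfl⟩ | rfl)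
    · fin_cases i <;> norm_num
    · norm_num
  · intro y hy z hz a b ha hb hab
    simp only [mem_ofPred_eq, Pi.add_apply, Pi.smul_apply, smul_eq_mul] at *
    obtain ⟨hy₁, hy₂⟩ := hy
    obtain ⟨hz₁, hz₂⟩ := hz
    constructor <;> nlinarith

/-- The triangular prism has a chain of five faces. -/
lemma exists_prism_flag : ∃ F : Fin 5 → {F // IsFaceOf F (prodP 1 2)}, StrictMono F := by
  have hle : ∀ z ∈ prodP 1 2, z 0 ≤ 1 ∧ z 1 + z 2 ≤ 1 ∧ z 1 - 2 * z 2 ≤ 1 := by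
    rintro _ ⟨a, ha, b, hb, rfl⟩
    exact ⟨le_one_of_mem_simplexF_one ha, le_one_of_mem_simplexF_two hb⟩
  have hmem : ∀ s : ℝ, -1 ≤ s → s ≤ 1 → ∀ b ∈ simplexF 2,
      Fin.append ![s] b ∈ prodP 1 2 := fun s h₁ h₂ b hb => ⟨_, mem_simplexF_one h₁ h₂, b, hb, rfl⟩
  have he₀ : ![1, 0] ∈ simplexF 2 :=
    subset_convexHull ℝ _ (Or.inl ⟨0, by ext j; fin_cases j <;> simp⟩)
  have he₁ : ![0, 1] ∈ simplexF 2 :=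
    subset_convexHull ℝ _ (Or.inl ⟨1, by ext j; fin_cases j <;> simp⟩)
  have he₂ : ![-1, -1] ∈ simplexF 2 :=
    subset_convexHull ℝ _ (Or.inr (by ext j; fin_cases j <;> simp))
  have hval : ∀ s a b : ℝ, (Fin.append ![s] ![a, b]) (0 : Fin 3) = s ∧
      (Fin.append ![s] ![a, b]) (1 : Fin 3) = a ∧ (Fin.append ![s] ![a, b]) (2 : Fin 3) = b :=
    fun s a b => ⟨rfl, rfl, rfl⟩
  have hface : ∀ (c₀ c₁ c₂ b : ℝ),
      (∀ z ∈ prodP 1 2, c₀ * z 0 + c₁ * z 1 + c₂ * z 2 ≤ b) →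
      IsFaceOf {z ∈ prodP 1 2 | c₀ * z 0 + c₁ * z 1 + c₂ * z 2 = b} (prodP 1 2) := by
    intro c₀ c₁ c₂ b h
    have hsum : ∀ z : Fin (1 + 2) → ℝ, ∑ i, (![c₀, c₁, c₂] : Fin (1 + 2) → ℝ) i * z i =
      c₀ * z 0 + c₁ * z 1 + c₂ * z 2 := fun z => Fin.sum_univ_three _
    exact ⟨![c₀, c₁, c₂], b, fun z hz => (hsum z).trans_le (h z hz), by simp only [hsum]⟩
  have h₁ := hface 1 1 0 2 fun z hz => by linarith [(hle z hz).1, (hle z hz).2.1, (hle z hz).2.2]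
  have h₂ := hface 1 1 1 2 fun z hz => by linarith [(hle z hz).1, (hle z hz).2.1, (hle z hz).2.2]
  have h₃ := hface 1 0 0 1 fun z hz => by linarith [(hle z hz).1, (hle z hz).2.1, (hle z hz).2.2]
  refine ⟨![⟨∅, isFaceOf_empty _⟩, ⟨_, h₁⟩, ⟨_, h₂⟩, ⟨_, h₃⟩, ⟨_, isFaceOf_self _⟩],
    Fin.strictMono_iff_lt_succ.2 fun i => ?_⟩
  fin_cases i
  · refine ssubset_iff_exists.2 ⟨empty_subset _, Fin.append ![1] ![1, 0],
      ⟨hmem 1 (by norm_num) le_rfl _ he₀, ?_⟩, notMem_empty _⟩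
    obtain ⟨e₀, e₁, e₂⟩ := hval 1 1 0
    linarith
  · obtain ⟨e₀, e₁, e₂⟩ := hval 1 0 1
    refine ssubset_iff_exists.2 ⟨?_, Fin.append ![1] ![0, 1],
      ⟨hmem 1 (by norm_num) le_rfl _ he₁, ?_⟩, fun h => ?_⟩
    · rintro z ⟨hz, h⟩
      exact ⟨hz, by linarith [(hle z hz).1, (hle z hz).2.1, (hle z hz).2.2]⟩
    · linarith
    · linarith [h.2]
  · obtain ⟨e₀, e₁, e₂⟩ := hval 1 (-1) (-1)
    refine ssubset_iff_exists.2 ⟨?_, Fin.append ![1] ![-1, -1],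
      ⟨hmem 1 (by norm_num) le_rfl _ he₂, ?_⟩, fun h => ?_⟩
    · rintro z ⟨hz, h⟩
      exact ⟨hz, by linarith [(hle z hz).1, (hle z hz).2.1, (hle z hz).2.2]⟩
    · linarith
    · linarith [h.2]
  · obtain ⟨e₀, e₁, e₂⟩ := hval (-1) 1 0
    refine ssubset_iff_exists.2 ⟨fun z hz => hz.1, Fin.append ![-1] ![1, 0],
      hmem (-1) le_rfl (by norm_num) _ he₀, fun h => ?_⟩
    linarith [h.2]

/-- A polytope that is combinatorially equivalent to the triangular prism is
three-dimensional. -/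
lemma homogRank_of_combEquiv_prism {N : ℕ} {T : Set (Fin N → ℝ)} (hT : T.Finite)
    (h : CombEquiv (convexHull ℝ T) (prodP 1 2)) : homogRank T = 4 := by
  obtain ⟨φ⟩ := combEquiv_iff.1 h
  rw [← homogRank_convexHull]
  apply le_antisymm
  · exact (homogRank_le_of_orderIso hT φ ⟨_, isFaceOf_self _⟩).trans (homogRank_le _)
  · obtain ⟨F, hF⟩ := exists_prism_flag
    have hmono : StrictMono fun i => homogRank (φ.symm (F i)).1 := fun i j hij =>
      homogRank_lt_of_isFaceOf (φ.symm (F i)).2 (φ.symm (F j)).2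
        (φ.symm.lt_iff_lt.2 (hF hij))
    have h₀ := hmono (show (0 : Fin 5) < 1 by decide)
    have h₁ := hmono (show (1 : Fin 5) < 2 by decide)
    have h₂ := hmono (show (2 : Fin 5) < 3 by decide)
    have h₃ := hmono (show (3 : Fin 5) < 4 by decide)
    have h₄ : homogRank (φ.symm (F 4)).1 ≤ homogRank (convexHull ℝ T) := by
      obtain ⟨_, _, hG⟩ := (φ.symm (F 4)).2
      rw [hG.2]
      exact homogRank_mono fun x hx => hx.1
    simp only at h₀ h₁ h₂ h₃
    omega

end Prism

section PrismVertices

variable {N : ℕ}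

/-- A polytope is the convex hull of its vertices. -/
lemma IsPolytope.convexHull_vertexSet {P : Set (Fin N → ℝ)} (hP : IsPolytope P) :
    convexHull ℝ (vertexSet P) = P := by
  classical
  obtain ⟨S, rfl⟩ := hP
  obtain ⟨T, hT, hmin⟩ := (S.powerset.filter fun T : Finset (Fin N → ℝ) =>
    convexHull ℝ (T : Set (Fin N → ℝ)) = convexHull ℝ (S : Set (Fin N → ℝ))).exists_minimal
    ⟨S, by simp⟩
  simp only [Finset.mem_filter, Finset.mem_powerset] at hT hmin
  obtain ⟨hTS, hTP⟩ := hT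
  refine Subset.antisymm (convexHull_min ?_ (convex_convexHull ℝ _)) ?_
  · rintro v ⟨c, b, -, hv⟩
    have : v ∈ ({v} : Set (Fin N → ℝ)) := rfl
    rw [hv] at this
    exact this.1
  · rw [← hTP]
    refine convexHull_mono fun t ht => ?_
    have hnot : t ∉ convexHull ℝ ((T.erase t : Finset _) : Set (Fin N → ℝ)) := by
      intro hmem
      have hle := hmin (y := T.erase t) ⟨(Finset.erase_subset _ _).trans hTS, ?_⟩
        (Finset.erase_subset _ _)
      · exact Finset.notMem_erase t T (hle ht)
      · rw [← hTP]
        refine Subset.antisymm (convexHull_mono (Finset.erase_subset t T))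
          (convexHull_min (fun x hx => ?_) (convex_convexHull ℝ _))
        by_cases hxt : x = t
        · rwa [hxt]
        · exact subset_convexHull ℝ _ (Finset.mem_erase.2 ⟨hxt, hx⟩)
    obtain ⟨f, u, hf, hu⟩ := geometric_hahn_banach_closed_point (convex_convexHull ℝ _)
      ((T.erase t).finite_toSet.isCompact_convexHull ℝ).isClosed hnot
    let g : (Fin N → ℝ) × ℝ →ₗ[ℝ] ℝ :=
      (f : (Fin N → ℝ) →ₗ[ℝ] ℝ) ∘ₗ LinearMap.fst ℝ _ _ - f t • LinearMap.snd ℝ _ _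
    have hg : ∀ x, g (homog x) = f x - f t := fun x => by simp [g, homog]
    have hlt : ∀ x ∈ T, x ≠ t → g (homog x) < 0 := fun x hx hxt => by
      rw [hg]; linarith [hf x (subset_convexHull ℝ _ (Finset.mem_erase.2 ⟨hxt, hx⟩))]
    have hgT : ∀ x ∈ (T : Set (Fin N → ℝ)), g (homog x) ≤ 0 := fun x hx => by
      by_cases hxt : x = t
      · rw [hg, hxt, sub_self]
      · exact (hlt x hx hxt).le
    refine isFaceOf_iff.2 ⟨g, apply_homog_nonpos_of_mem_convexHull hgT, ?_⟩
    have hset : {x ∈ (T : Set (Fin N → ℝ)) | g (homog x) = 0} = {t} := by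
      ext x
      refine ⟨fun hx => by_contra fun hxt => (hlt x hx.1 hxt).ne hx.2, ?_⟩
      rintro rfl
      exact ⟨ht, by rw [hg, sub_self]⟩
    rw [setOf_mem_convexHull_eq_zero hgT, hset, convexHull_singleton]

/-- The linear coordinates dual to a linearly independent family. -/
lemma LinearIndependent.exists_dual_family {ι K E : Type*} [DecidableEq ι] [Field K]
    [AddCommGroup E] [Module K E] {v : ι → E} (hv : LinearIndependent K v) :
    ∃ h : ι → E →ₗ[K] K, ∀ i j, h j (v i) = if i = j then 1 else 0 := by
  obtain ⟨g, hg⟩ := LinearMap.exists_leftInverse_of_injective (Finsupp.linearCombination K v)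
    (LinearMap.ker_eq_bot.2 hv)
  refine ⟨fun j => Finsupp.lapply j ∘ₗ g, fun i j => ?_⟩
  have h := LinearMap.congr_fun hg (Finsupp.single i 1)
  simp only [LinearMap.comp_apply, Finsupp.linearCombination_single, one_smul,
    LinearMap.id_apply] at h
  simp [h, Finsupp.single_apply]

/-- If a subset `S` of a finite set `V` is given, then `V` has a subset of `rank V - rank S`
points that are independent of `S`. -/
lemma exists_independent_apices {V S : Set (Fin N → ℝ)} (hV : V.Finite) (hS : S ⊆ V) :
    ∃ (k : ℕ) (r : Fin k → Fin N → ℝ) (h : Fin k → (Fin N → ℝ) × ℝ →ₗ[ℝ] ℝ),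
      homogRank S + k = homogRank V ∧ Function.Injective r ∧ range r ⊆ V \ S ∧
      (∀ j, ∀ x ∈ S, h j (homog x) = 0) ∧
      ∀ i j, h j (homog (r i)) = if i = j then 1 else 0 := by
  classical
  obtain ⟨B₀, hB₀S, -, hspan₀, hB₀⟩ := exists_linearIndepOn_extension (K := ℝ) (v := homog)
    (linearIndepOn_empty ℝ homog) (empty_subset S)
  obtain ⟨B, hBV, hB₀B, hspan, hB⟩ := exists_linearIndepOn_extension hB₀ (hB₀S.trans hS)
  have hrank : ∀ {X Y : Set (Fin N → ℝ)}, Y ⊆ V → X ⊆ Y → LinearIndepOn ℝ homog X →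
      homog '' Y ⊆ Submodule.span ℝ (homog '' X) → homogRank Y = X.ncard := by
    intro X Y hYV hXY hX hYX
    have := (hV.subset (hXY.trans hYV)).fintype
    have hspan : homogSpan Y = Submodule.span ℝ (range fun x : X => homog x) := by
      rw [← image_eq_range]
      exact le_antisymm (Submodule.span_le.2 hYX) (homogSpan_mono hXY)
    rw [homogRank, hspan, finrank_span_eq_card hX, ← Nat.card_eq_fintype_card, Nat.card_coe_set_eq]
  have hBfin := hV.subset hBV
  have := (hBfin.subset (sdiff_subset (t := B₀))).fintype
  obtain ⟨h, hh⟩ := LinearIndependent.exists_dual_family hB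
  let e := Finite.equivFin ↥(B \ B₀)
  have hzero : ∀ b (hb : b ∈ B \ B₀), ∀ x ∈ S, h ⟨b, hb.1⟩ (homog x) = 0 := by
    intro b hb x hx
    have hle : Submodule.span ℝ (homog '' B₀) ≤ LinearMap.ker (h ⟨b, hb.1⟩) := by
      refine Submodule.span_le.2 ?_
      rintro _ ⟨y, hy, rfl⟩
      refine (hh ⟨y, hB₀B hy⟩ ⟨b, hb.1⟩).trans (if_neg fun heq => hb.2 ?_)
      rwa [← Subtype.mk.inj heq]
    exact hle (hspan₀ (mem_image_of_mem _ hx))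
  refine ⟨_, fun i => (e.symm i).1, fun j => h ⟨(e.symm j).1, (e.symm j).2.1⟩, ?_,
    Subtype.val_injective.comp e.symm.injective, ?_, fun j => hzero _ (e.symm j).2, fun i j => ?_⟩
  · rw [hrank hS hB₀S hB₀ hspan₀, hrank Subset.rfl hBV hB hspan, Nat.card_coe_set_eq, add_comm]
    exact ncard_sdiff_add_ncard_of_subset hB₀B hBfin
  · rintro _ ⟨i, rfl⟩
    refine ⟨hBV (e.symm i).2.1, fun hS => ?_⟩
    have h₁ := hzero _ (e.symm i).2 _ hS
    have h₂ := hh ⟨(e.symm i).1, (e.symm i).2.1⟩ ⟨(e.symm i).1, (e.symm i).2.1⟩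
    rw [if_pos rfl] at h₂
    exact one_ne_zero (h₂.symm.trans h₁)
  · refine (hh ⟨(e.symm i).1, (e.symm i).2.1⟩ _).trans (if_congr ?_ rfl rfl)
    rw [Subtype.mk.injEq, Subtype.val_inj, e.symm.injective.eq_iff]

end PrismVertices

theorem classification_with_prism_vertices (N d : ℕ) (P : Set (Fin N → ℝ))
    (hP : IsPolytope P) (hdP : pdim P = d) (hv : vertexCount P = d + 4)
    (hprism : ∃ S : Finset (Fin N → ℝ), (S : Set (Fin N → ℝ)) ⊆ vertexSet P ∧
      S.card = 6 ∧ CombEquiv (convexHull ℝ (S : Set (Fin N → ℝ))) (prodP 1 2)) :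
    ∃ (k' : ℕ) (P' : Set (Fin N → ℝ)), IsKFoldPyramidOver k' P P' ∧
      ((∃ n m : ℕ, 1 ≤ n ∧ 1 ≤ m ∧
          CombEquiv P' (joinP (prodP 1 2) (sumP n m))) ∨
       (∃ (x : Fin N → ℝ) (k : ℕ),
          CombEquiv (convexHull ℝ (vertexSet P' \ {x})) (pyrK k (prodP 1 2)) ∧
          P' = convexHull ℝ (convexHull ℝ (vertexSet P' \ {x}) ∪ {x}))) := by
  obtain ⟨S, hSV, hS6, hS⟩ := hprism
  have hVfin : (vertexSet P).Finite := finite_of_ncard_pos (by rw [vertexCount] at hv; omega)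
  have hconv := hP.convexHull_vertexSet
  have hSrank := homogRank_of_combEquiv_prism S.finite_toSet hS
  have hPrank := homogRank_eq_pdim_add_one P
  rw [← hconv, homogRank_convexHull, hconv, hdP] at hPrank
  obtain ⟨k, r, h, hk, hr, hrV, hhS, hhr⟩ := exists_independent_apices hVfin hSV
  have hdisj : Disjoint (S : Set (Fin N → ℝ)) (range r) :=
    disjoint_left.2 fun x hxS hxr => (hrV hxr).2 hxS
  have hsub : ↑S ∪ range r ⊆ vertexSet P := union_subset hSV (hrV.trans sdiff_subset)
  have hcard : (vertexSet P \ (↑S ∪ range r)).ncard = 1 := by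
    have h₁ := ncard_sdiff_add_ncard_of_subset hsub hVfin
    rw [ncard_union_eq hdisj S.finite_toSet (finite_range r), ncard_coe_finset, hS6,
      ← Nat.card_coe_set_eq (range r), Nat.card_range_of_injective hr, Nat.card_fin,
      show (vertexSet P).ncard = d + 4 from hv] at h₁
    omega
  obtain ⟨x, hx⟩ := ncard_eq_one.1 hcard
  have hrest : vertexSet P \ {x} = ↑S ∪ range r := by
    rw [← hx, sdiff_sdiff_right_self]
    exact inter_eq_right.2 hsub
  have hxV : x ∈ vertexSet P := (hx.ge (mem_singleton x)).1
  refine ⟨0, P, rfl, Or.inr ⟨x, k, ?_, ?_⟩⟩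
  · rw [hrest, ← convexHull_convexHull_union]
    refine hS.pyrK r h (fun j y hy => ?_) hhr
    have hle : homogSpan (S : Set (Fin N → ℝ)) ≤ LinearMap.ker (h j) := by
      refine Submodule.span_le.2 ?_
      rintro _ ⟨z, hz, rfl⟩
      exact hhS j z hz
    rw [← homogSpan_convexHull] at hle
    exact hle (homog_mem_homogSpan hy)
  · rw [convexHull_convexHull_union, sdiff_union_of_subset (singleton_subset_iff.2 hxV), hconv]

end
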